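/- There exists a Hilbert space $X$ and a bounded linear operator $T : X \to X$ such that the restriction of $T$ to its closed $T$-invariant subspace $CR(T)$ of chain recurrent vectors is not a chain recurrent operator; in fact $T$ can be chosen so that $CR(T\vert_{CR(T)}) = \{0\}$ while $CR(T) \ne \{0\}$. -/

import Mathlib

/-- A δ-chain for `T` from `f` to `g`: a finite sequence `(u l)_{l=0}^m`, `m ≥ 1`,
with `u 0 = f`, `u m = g`, and `‖u l - T (u (l-1))‖ < δ` for `1 ≤ l ≤ m`. -/
def IsDeltaChain {X : Type*} [NormedAddCommGroup X] [NormedSpace ℂ X]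
    (T : X →L[ℂ] X) (δ : ℝ) (f g : X) : Prop :=
  ∃ (m : ℕ) (u : ℕ → X), 1 ≤ m ∧ u 0 = f ∧ u m = g ∧
    ∀ l, 1 ≤ l → l ≤ m → ‖u l - T (u (l - 1))‖ < δ

/-- `f` is a chain recurrent vector for `T`. -/
def ChainRecVec {X : Type*} [NormedAddCommGroup X] [NormedSpace ℂ X]
    (T : X →L[ℂ] X) (f : X) : Prop :=
  ∀ δ : ℝ, 0 < δ → IsDeltaChain T δ f f

/-- `f` is chain recurrent for the restriction of `T` to the subset `S`
(all points of the chain are required to lie in `S`). -/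
def RelChainRecVec {X : Type*} [NormedAddCommGroup X] [NormedSpace ℂ X]
    (T : X →L[ℂ] X) (S : Set X) (f : X) : Prop :=
  ∀ δ : ℝ, 0 < δ → ∃ (m : ℕ) (u : ℕ → X), 1 ≤ m ∧ (∀ l ≤ m, u l ∈ S) ∧
    u 0 = f ∧ u m = f ∧ ∀ l, 1 ≤ l → l ≤ m → ‖u l - T (u (l - 1))‖ < δ

namespace CRex

noncomputable abbrev Y := lp (fun _ : ℕ × ℕ => ℂ) 2

noncomputable abbrev X := WithLp 2 (ℂ × Y)

noncomputable def sfun (y : ℕ × ℕ → ℂ) : ℕ × ℕ → ℂ :=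
  fun i => if i.2 < 2 * i.1 then 2 * y (i.1, i.2 + 1) else 0

lemma sfun_sum (y : Y) (s : Finset (ℕ × ℕ)) :
    ∑ i ∈ s, ‖sfun y i‖ ^ (2 : ENNReal).toReal ≤ (2 * ‖y‖) ^ (2 : ENNReal).toReal := by
  have hinj : Function.Injective (fun i : ℕ × ℕ => (i.1, i.2 + 1)) := by
    rintro ⟨a, b⟩ ⟨c, d⟩ h
    simpa using h
  have h := lp.sum_rpow_le_norm_rpow (p := 2) (by norm_num) y (s.map ⟨_, hinj⟩)
  rw [Finset.sum_map] at h
  rw [Real.mul_rpow (by norm_num) (norm_nonneg _)]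
  refine le_trans ?_ (mul_le_mul_of_nonneg_left h (by positivity))
  rw [Finset.mul_sum]
  refine Finset.sum_le_sum fun i _ => ?_
  rw [← Real.mul_rpow (by norm_num) (norm_nonneg _)]
  refine Real.rpow_le_rpow (norm_nonneg _) ?_ (by norm_num)
  unfold sfun
  split_ifs
  · simp
  · simp

noncomputable def S : Y →L[ℂ] Y :=
  LinearMap.mkContinuous
    { toFun := fun y => ⟨sfun y, memℓp_gen' (sfun_sum y)⟩
      map_add' := by
        intro x y
        ext i
        simp only [sfun, lp.coeFn_add, Pi.add_apply]
        split_ifs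
        · ring
        · simp
      map_smul' := by
        intro c y
        ext i
        simp only [sfun, lp.coeFn_smul, Pi.smul_apply, RingHom.id_apply, smul_eq_mul]
        split_ifs
        · ring
        · simp }
    2 (by
      intro y
      exact lp.norm_le_of_forall_sum_le (by norm_num) (by positivity) (sfun_sum y))

lemma S_apply (y : Y) (i : ℕ × ℕ) :
    (S y) i = if i.2 < 2 * i.1 then 2 * y (i.1, i.2 + 1) else 0 := rfl

lemma S_single_succ (n j : ℕ) (hj : j < 2 * n) (c : ℂ) :
    S (lp.single 2 (n, j + 1) c) = lp.single 2 (n, j) (2 * c) := by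
  ext ⟨a, b⟩
  rw [S_apply]
  simp only [lp.single_apply, Pi.single_apply, Prod.mk.injEq, add_left_inj]
  by_cases h : a = n ∧ b = j
  · obtain ⟨rfl, rfl⟩ := h
    simp [hj]
  · simp [h]

lemma S_single_zero (n : ℕ) (c : ℂ) :
    S (lp.single 2 (n, 0) c) = 0 := by
  ext ⟨a, b⟩
  rw [S_apply]
  simp [lp.single_apply, Pi.single_apply]

noncomputable def v : Y := ⟨fun i => (1 / 2) ^ i.1 * (1 / 2) ^ i.2, by
  apply memℓp_gen
  have h : Summable fun n : ℕ => ((1 / 4 : ℝ)) ^ n :=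
    summable_geometric_of_lt_one (by norm_num) (by norm_num)
  have := h.mul_of_nonneg h (fun _ => by positivity) (fun _ => by positivity)
  refine this.congr fun i => ?_
  simp [mul_pow, ← pow_mul, mul_comm]
  norm_num [pow_mul']⟩

lemma v_apply (n : ℕ) : v (n, 0) = (1 / 2) ^ n := by
  simp [v]

noncomputable def T : X →L[ℂ] X :=
  (WithLp.prodContinuousLinearEquiv 2 ℂ ℂ Y).symm.toContinuousLinearMap ∘L
    (((innerSL ℂ v).prod S) ∘L (ContinuousLinearMap.snd ℂ ℂ Y)) ∘L
    (WithLp.prodContinuousLinearEquiv 2 ℂ ℂ Y).toContinuousLinearMap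

lemma T_apply (x : X) : T x = WithLp.toLp 2 (inner ℂ v x.snd, S x.snd) := rfl

lemma T_snd (x : X) : (T x).snd = S x.snd := rfl

lemma coord_le (x : X) (i : ℕ × ℕ) : ‖x.snd i‖ ≤ ‖x‖ :=
  (lp.norm_apply_le_norm (by norm_num) x.snd i).trans (WithLp.norm_snd_le _ x)

lemma periodic {f : X} {δ : ℝ} (h : IsDeltaChain T δ f f) :
    ∃ (m : ℕ) (w : ℕ → X), 1 ≤ m ∧ (∀ k, w (k * m) = f) ∧
      ∀ l, ‖w (l + 1) - T (w l)‖ < δ := by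
  obtain ⟨m, u, hm, h0, h1, h2⟩ := h
  refine ⟨m, fun l => u (l % m), hm, fun k => by simpa using h0, fun l => ?_⟩
  have hlt : l % m < m := Nat.mod_lt _ hm
  have key : u ((l + 1) % m) = u (l % m + 1) := by
    rw [Nat.add_mod_eq_ite]
    rcases Nat.eq_or_lt_of_le hm with h | h
    · subst h
      simp [Nat.mod_one, h0, h1]
    · rw [Nat.mod_eq_of_lt h]
      split_ifs with h3
      · have : l % m + 1 = m := by omega
        rw [this]
        simp [h0, h1]
      · rfl
  have := h2 (l % m + 1) (by omega) (by omega)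
  simp only [key]
  simpa using this

lemma bound {δ : ℝ} {w : ℕ → X} (hw : ∀ l, ‖w (l + 1) - T (w l)‖ < δ) (n : ℕ) :
    ∀ k j l : ℕ, 2 * n ≤ j + k → k + 1 ≤ l → ‖(w l).snd (n, j)‖ ≤ (2 ^ (k + 1) - 1) * δ := by
  intro k
  have hδ : 0 < δ := lt_of_le_of_lt (norm_nonneg _) (hw 0)
  have step : ∀ j l, ‖(w (l + 1)).snd (n, j)‖ ≤ δ + ‖(S (w l).snd) (n, j)‖ := by
    intro j l
    have h1 := (coord_le (w (l + 1) - T (w l)) (n, j)).trans (hw l).le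
    have h2 : (w (l + 1) - T (w l)).snd (n, j) = (w (l + 1)).snd (n, j) - (S (w l).snd) (n, j) := rfl
    rw [h2] at h1
    have := norm_le_norm_add_norm_sub' ((w (l + 1)).snd (n, j)) ((S (w l).snd) (n, j))
    linarith
  induction k with
  | zero =>
    intro j l hj hl
    obtain ⟨l, rfl⟩ : ∃ l', l = l' + 1 := ⟨l - 1, by omega⟩
    have := step j l
    rw [S_apply, if_neg (by simpa using hj)] at this
    norm_num at this ⊢
    exact this
  | succ k ih =>
    intro j l hj hl
    obtain ⟨l, rfl⟩ : ∃ l', l = l' + 1 := ⟨l - 1, by omega⟩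
    have h1 := step j l
    have h3 := ih (j + 1) l (by omega) (by omega)
    have h4 : ‖(S (w l).snd) (n, j)‖ ≤ 2 * ‖(w l).snd (n, j + 1)‖ := by
      rw [S_apply]
      split_ifs
      · simp
      · simp
    rw [pow_succ]
    nlinarith

lemma snd_zero {f : X} (hf : ChainRecVec T f) : f.snd = 0 := by
  ext ⟨n, j⟩
  have key : ∀ δ : ℝ, 0 < δ → ‖f.snd (n, j)‖ ≤ (2 ^ (2 * n + 1) - 1) * δ := by
    intro δ hδ
    obtain ⟨m, w, hm, h1, h2⟩ := periodic (hf δ hδ)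
    have := bound h2 n (2 * n) j ((2 * n + 1) * m) (by omega) (by nlinarith)
    rwa [h1] at this
  have hpos : (0 : ℝ) < 2 ^ (2 * n + 1) - 1 := by
    have : (1 : ℝ) < 2 ^ (2 * n + 1) := one_lt_pow₀ (by norm_num) (by omega)
    linarith
  have : ‖f.snd (n, j)‖ ≤ 0 := by
    refine le_of_forall_pos_le_add fun ε hε => ?_
    have := key (ε / (2 ^ (2 * n + 1) - 1)) (by positivity)
    rw [mul_div_cancel₀ _ hpos.ne'] at this
    linarith
  simpa using this

lemma T_zero_of {f : X} (hf : f.snd = 0) : T f = 0 := by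
  rw [T_apply, hf]
  simp

noncomputable def e : X := WithLp.toLp 2 (1, 0)

noncomputable def g (n : ℕ) : X := WithLp.toLp 2 (0, lp.single 2 (n, 2 * n) ((1 / 2) ^ n))

lemma iter_snd (n k : ℕ) (hk : k ≤ 2 * n) :
    ((T^[k]) (g n)).snd = lp.single 2 (n, 2 * n - k) (2 ^ k * (1 / 2) ^ n) := by
  induction k with
  | zero => simp [g]
  | succ k ih =>
    rw [Function.iterate_succ_apply', T_snd, ih (by omega)]
    have h : 2 * n - k = (2 * n - (k + 1)) + 1 := by omega
    rw [h, S_single_succ n _ (by omega)]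
    congr 1
    ring

lemma iter_last (n : ℕ) : (T^[2 * n + 1]) (g n) = e := by
  rw [Function.iterate_succ_apply', T_apply, iter_snd n _ le_rfl, Nat.sub_self, S_single_zero,
    lp.inner_single_right, v_apply]
  unfold e
  congr 2
  have h2 : (starRingEnd ℂ) 2 = 2 := Complex.conj_ofNat 2
  simp only [RCLike.inner_apply, map_pow, map_div₀, map_one, h2]
  rw [pow_mul, ← mul_pow, ← mul_pow]
  norm_num

lemma e_rec : ChainRecVec T e := by
  intro δ hδ
  obtain ⟨n, hn⟩ := exists_pow_lt_of_lt_one hδ (show (1 / 2 : ℝ) < 1 by norm_num)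
  refine ⟨2 * n + 2, fun l => if l = 0 then e else (T^[l - 1]) (g n), by omega, by simp, ?_, ?_⟩
  · simpa using iter_last n
  · intro l h1 h2
    obtain ⟨l, rfl⟩ : ∃ l', l = l' + 1 := ⟨l - 1, by omega⟩
    rcases Nat.eq_zero_or_pos l with rfl | hl
    · have : T e = 0 := T_zero_of rfl
      simp only [zero_add, Nat.sub_self, if_true, one_ne_zero, if_false, this, sub_zero]
      simpa [g, lp.norm_single] using hn
    · obtain ⟨l, rfl⟩ : ∃ l', l = l' + 1 := ⟨l - 1, by omega⟩
      simpa [Function.iterate_succ_apply', -Function.iterate_succ] using hδ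

end CRex

theorem stmt_6 :
    ∃ (X : Type) (_ : NormedAddCommGroup X) (_ : InnerProductSpace ℂ X)
      (_ : CompleteSpace X) (T : X →L[ℂ] X),
      {f : X | ChainRecVec T f ∧ RelChainRecVec T {g : X | ChainRecVec T g} f} = {0} ∧
      {f : X | ChainRecVec T f} ≠ {0} := by
  refine ⟨CRex.X, inferInstance, inferInstance, inferInstance, CRex.T, ?_, ?_⟩
  · have h0 : ChainRecVec CRex.T 0 := fun δ hδ =>
      ⟨1, fun _ => 0, le_rfl, rfl, rfl, fun l _ _ => by simpa using hδ⟩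
    ext f
    simp only [Set.mem_setOf_eq, Set.mem_singleton_iff]
    constructor
    · rintro ⟨-, hf⟩
      have : ‖f‖ ≤ 0 := by
        refine le_of_forall_pos_le_add fun δ hδ => ?_
        obtain ⟨m, u, hm, hS, -, h1, h2⟩ := hf δ hδ
        have h3 := h2 m hm le_rfl
        rw [CRex.T_zero_of (CRex.snd_zero (hS (m - 1) (by omega))), h1, sub_zero] at h3
        linarith
      simpa using this
    · rintro rfl
      exact ⟨h0, fun δ hδ => ⟨1, fun _ => 0, le_rfl, fun _ _ => h0, rfl, rfl,
        fun l _ _ => by simpa using hδ⟩⟩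
  · intro h
    have h1 : CRex.e ∈ {f : CRex.X | ChainRecVec CRex.T f} := CRex.e_rec
    rw [h, Set.mem_singleton_iff] at h1
    have h2 : CRex.e.fst = (0 : CRex.X).fst := by rw [h1]
    simp [CRex.e] at h2
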